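/- (Lovász) For every rooted digraph D = (V+r, E) there exists a spanning subgraph F such that λ_D(r,v) = λ_F(r,v) = ϱ_F(v) holds for every vertex v ∈ V. -/

import Mathlib

/- Common setup: a rooted digraph `D = (V+r, E)` is modelled as a finite
vertex type `α` (whose elements are `V ∪ {r}`), a finite edge type `E`
(allowing parallel edges, i.e. a multigraph) and maps `tail head : E → α`.
Subgraphs / edge subsets are sets `F : Set E`; the whole digraph `D`
corresponds to the edge set `Set.univ`.  "`v ∈ V`" is rendered as `v ≠ r`,
and a vertex subset `X ⊆ V` as `X : Set α` with `r ∉ X`. -/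

/-- In-degree of the vertex `v` in the digraph with edge set `F`. -/
noncomputable def inDeg {α E : Type*} (head : E → α) (F : Set E) (v : α) : ℕ :=
  {e ∈ F | head e = v}.ncard

/-- `ϱ_F(X)`: the number of edges of `F` entering the vertex set `X`
(tail outside `X`, head in `X`). -/
noncomputable def rho {α E : Type*} (tail head : E → α) (F : Set E) (X : Set α) : ℕ :=
  {e ∈ F | tail e ∉ X ∧ head e ∈ X}.ncard

/-- `p` is a directed path from `r` to `v` using edges of `F`:
a nonempty list of consecutive edges, starting at `r`, ending at `v`, and
visiting pairwise distinct vertices. -/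
def IsRVPath {α E : Type*} (tail head : E → α) (F : Set E) (r v : α) (p : List E) : Prop :=
  (∀ e ∈ p, e ∈ F) ∧
  List.Chain' (fun e f => head e = tail f) p ∧
  (p.map tail).Nodup ∧ (∀ e ∈ p, tail e ≠ v) ∧
  (∃ e, p.head? = some e ∧ tail e = r) ∧
  (∃ e, p.getLast? = some e ∧ head e = v)

/-- There exist `n` pairwise edge-disjoint directed paths from `r` to `v`
in the edge set `F`. -/
def HasEDPaths {α E : Type*} (tail head : E → α) (F : Set E) (r v : α) (n : ℕ) : Prop :=
  ∃ P : Fin n → List E, (∀ i, IsRVPath tail head F r v (P i)) ∧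
    ∀ i j, i ≠ j → ∀ e, e ∈ P i → e ∉ P j

/-- `λ_F(r,v)`: the local edge-connectivity from `r` to `v`, i.e. the maximum
number of pairwise edge-disjoint directed paths from `r` to `v` in `F`. -/
noncomputable def lam {α E : Type*} (tail head : E → α) (F : Set E) (r v : α) : ℕ :=
  sSup {n | HasEDPaths tail head F r v n}

/-- `X` is a `v`-tight vertex set in the digraph with edge set `F` and root `r`:
`X ⊆ V` (i.e. `r ∉ X`), `v ∈ X` and `ϱ_F(X) = λ_F(r,v)`. -/
def Tight {α E : Type*} (tail head : E → α) (F : Set E) (r v : α) (X : Set α) : Prop :=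
  v ∈ X ∧ r ∉ X ∧ rho tail head F X = lam tail head F r v

/-- The digraph with edge set `F` is a flame with root `r`:
`λ_F(r,v) = ϱ_F(v)` for every `v ∈ V`. -/
def IsFlame {α E : Type*} (tail head : E → α) (F : Set E) (r : α) : Prop :=
  ∀ v, v ≠ r → lam tail head F r v = inDeg head F v

/-- `F` is a maximal flame within the ambient edge set `A`:
`λ_A(r,v) = λ_F(r,v) = ϱ_F(v)` for every `v ∈ V`. -/
def IsMaxFlameIn {α E : Type*} (tail head : E → α) (A : Set E) (r : α) (F : Set E) : Prop :=
  F ⊆ A ∧ ∀ v, v ≠ r →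
    lam tail head A r v = lam tail head F r v ∧
    lam tail head F r v = inDeg head F v

/-- A closed directed walk in `F` with pairwise distinct edges.  (If every
vertex is entered by at most one edge of `F`, the existence of such a walk is
equivalent to the existence of an undirected cycle in `F`.) -/
def IsDicycle {α E : Type*} (tail head : E → α) (F : Set E) (p : List E) : Prop :=
  p.Nodup ∧ (∀ e ∈ p, e ∈ F) ∧
  List.Chain' (fun e f => head e = tail f) p ∧
  (∃ e f, p.head? = some e ∧ p.getLast? = some f ∧ head f = tail e)

/-- `B` is a branching: every vertex is entered by at most one edge of `B` and,
disregarding edge directions, `B` contains no cycle (under the in-degree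
condition this is equivalent to containing no directed cycle). -/
def IsBranching {α E : Type*} (tail head : E → α) (B : Set E) : Prop :=
  (∀ v, inDeg head B v ≤ 1) ∧ ∀ p : List E, ¬ IsDicycle tail head B p

/-- The head-set of an edge set `B`: the vertices entered by an edge of `B`. -/
def headSet {α E : Type*} (head : E → α) (B : Set E) : Set α := {v | ∃ e ∈ B, head e = v}

/-- Independence in the gammoid `G_D(v)` (with `D` the whole digraph, edge set
`Set.univ`): `X ⊆ in_D(v)` is independent if there are `|X|` pairwise
edge-disjoint directed paths from `r` to `v` in `D` whose set of last edges is
exactly `X`. -/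
def GammoidIndep {α E : Type*} (tail head : E → α) (r v : α) (X : Set E) : Prop :=
  ∃ P : Fin X.ncard → List E,
    (∀ i, IsRVPath tail head Set.univ r v (P i)) ∧
    (∀ i j, i ≠ j → ∀ e, e ∈ P i → e ∉ P j) ∧
    (∀ e, e ∈ X ↔ ∃ i, (P i).getLast? = some e)

section Paths

variable {α E : Type*} {tail head : E → α}

/-- The one-step relation of the digraph with edge set `F`. -/
def EdgeStep (tail head : E → α) (F : Set E) (a b : α) : Prop :=
  ∃ e ∈ F, tail e = a ∧ head e = b

lemma exists_isRVPath_of_reachable {F : Set E} {x v : α}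
    (h : Relation.ReflTransGen (EdgeStep tail head F) x v) (hx : x ≠ v) :
    ∃ p, IsRVPath tail head F x v p := by
  induction h using Relation.ReflTransGen.head_induction_on with
  | refl => exact absurd rfl hx
  | @head x y hxy _ ih =>
    obtain ⟨e, he, rfl, rfl⟩ := hxy
    by_cases hy : head e = v
    · exact ⟨[e], by simpa using he, List.isChain_singleton e, by simp, by simpa using hx,
        ⟨e, by simp, rfl⟩, ⟨e, by simp, hy⟩⟩
    · obtain ⟨p, hpF, hchain, hnodup, hv, ⟨a, ha, hae⟩, b, hb, hbv⟩ := ih hy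
      by_cases hmem : tail e ∈ p.map tail
      · obtain ⟨f, hf, hfe⟩ := List.mem_map.1 hmem
        obtain ⟨l₁, l₂, rfl⟩ := List.append_of_mem hf
        have hsub : ∀ g ∈ f :: l₂, g ∈ l₁ ++ f :: l₂ := fun g hg => List.mem_append_right _ hg
        refine ⟨f :: l₂, fun g hg => hpF g (hsub g hg), hchain.right_of_append, ?_,
          fun g hg => hv g (hsub g hg), ⟨f, rfl, hfe⟩, ⟨b, ?_, hbv⟩⟩
        · rw [List.map_append] at hnodup
          exact hnodup.of_append_right
        · rw [← hb, List.getLast?_append_of_ne_nil _ (by simp)]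
      · cases p with
        | nil => simp at ha
        | cons c l =>
          obtain rfl : c = a := by simpa using ha
          refine ⟨e :: c :: l, ?_, ?_, ?_, ?_, ⟨e, rfl, rfl⟩, ⟨b, ?_, hbv⟩⟩
          · exact List.forall_mem_cons.2 ⟨he, hpF⟩
          · exact List.isChain_cons_cons.2 ⟨hae.symm, hchain⟩
          · exact List.nodup_cons.2 ⟨hmem, hnodup⟩
          · exact List.forall_mem_cons.2 ⟨hx, hv⟩
          · rw [← hb, List.getLast?_cons_cons]

lemma exists_edge_entering {X : Set α} {a b : E} : ∀ {p : List E},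
    List.IsChain (fun e f => head e = tail f) p → p.head? = some a → tail a ∉ X →
      p.getLast? = some b → head b ∈ X → ∃ e ∈ p, tail e ∉ X ∧ head e ∈ X
  | [], _, ha, _, _, _ => by simp at ha
  | [c], _, ha, haX, hb, hbX => by
    obtain rfl : c = a := by simpa using ha
    obtain rfl : c = b := by simpa using hb
    exact ⟨c, by simp, haX, hbX⟩
  | c :: d :: l, hp, ha, haX, hb, hbX => by
    obtain rfl : c = a := by simpa using ha
    obtain ⟨hcd, hp⟩ := List.isChain_cons_cons.1 hp
    by_cases hc : head c ∈ X
    · exact ⟨c, by simp, haX, hc⟩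
    · obtain ⟨e, he, heX⟩ := exists_edge_entering (a := d) hp rfl (hcd ▸ hc)
        (by rwa [List.getLast?_cons_cons] at hb) hbX
      exact ⟨e, List.mem_cons_of_mem _ he, heX⟩

end Paths

section Menger

variable {α E : Type*} [Fintype E] {tail head : E → α}

lemma rho_eq_sum (F : Set E) (X : Set α) [DecidablePred fun e => e ∈ F ∧ tail e ∉ X ∧ head e ∈ X] :
    rho tail head F X = ∑ e, if e ∈ F ∧ tail e ∉ X ∧ head e ∈ X then 1 else 0 := by
  rw [rho, Finset.sum_boole, Set.ncard_eq_toFinset_card']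
  simp

lemma rho_inter_add_rho_union_le (F : Set E) (X Y : Set α) :
    rho tail head F (X ∩ Y) + rho tail head F (X ∪ Y) ≤
      rho tail head F X + rho tail head F Y := by
  classical
  simp only [rho_eq_sum, ← Finset.sum_add_distrib]
  refine Finset.sum_le_sum fun e _ => ?_
  simp only [Set.mem_inter_iff, Set.mem_union]
  by_cases h1 : e ∈ F <;> by_cases h2 : tail e ∈ X <;> by_cases h3 : tail e ∈ Y <;>
    by_cases h4 : head e ∈ X <;> by_cases h5 : head e ∈ Y <;> simp [h1, h2, h3, h4, h5]

lemma rho_mono {F G : Set E} (h : F ⊆ G) (X : Set α) :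
    rho tail head F X ≤ rho tail head G X :=
  Set.ncard_le_ncard (fun _ he => ⟨h he.1, he.2⟩) (Set.toFinite _)

lemma rho_le_rho_diff_singleton_add_one (F : Set E) (X : Set α) (e : E) :
    rho tail head F X ≤ rho tail head (F \ {e}) X + 1 := by
  refine le_trans (Set.ncard_le_ncard (t := insert e
    {f ∈ F \ {e} | tail f ∉ X ∧ head f ∈ X}) ?_ (Set.toFinite _)) (Set.ncard_insert_le _ _)
  rintro f ⟨hf, hX⟩
  by_cases h : f = e
  · exact Or.inl h
  · exact Or.inr ⟨⟨hf, h⟩, hX⟩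

lemma rho_diff_singleton_of_not_enters (F : Set E) (X : Set α) (e : E)
    (h : ¬ (tail e ∉ X ∧ head e ∈ X)) :
    rho tail head (F \ {e}) X = rho tail head F X := by
  refine le_antisymm (rho_mono Set.sdiff_subset X) (Set.ncard_le_ncard ?_ (Set.toFinite _))
  rintro f ⟨hf, hX⟩
  exact ⟨⟨hf, fun hfe => h (hfe ▸ hX)⟩, hX⟩

lemma HasEDPaths.le_rho {F : Set E} {r v : α} {n : ℕ} (h : HasEDPaths tail head F r v n)
    {X : Set α} (hv : v ∈ X) (hr : r ∉ X) : n ≤ rho tail head F X := by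
  obtain ⟨P, hP, hdisj⟩ := h
  have hent : ∀ i, ∃ e ∈ P i, tail e ∉ X ∧ head e ∈ X := by
    intro i
    obtain ⟨-, hchain, -, -, ⟨a, ha, har⟩, b, hb, hbv⟩ := hP i
    exact exists_edge_entering hchain ha (har ▸ hr) hb (hbv ▸ hv)
  choose g hg hgX using hent
  have hinj : Function.Injective g := fun i j hij => by
    by_contra hne
    exact hdisj i j hne (g i) (hg i) (hij ▸ hg j)
  calc n = (Set.range g).ncard := by
        rw [← Set.image_univ, Set.ncard_image_of_injective _ hinj]; simp
    _ ≤ rho tail head F X := Set.ncard_le_ncard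
        (by rintro _ ⟨i, rfl⟩; exact ⟨(hP i).1 _ (hg i), hgX i⟩) (Set.toFinite _)

/-- If every cut separating `v` from `r` has at least `k + 1` edges once an edge from `r` to `x`
is added, then one may remove edges so that every cut keeps at least `k` edges and the removed
edges connect `x` or `r` to `v`. -/
lemma exists_subset_le_rho_and_reachable [Finite α] {r v : α} (hvr : v ≠ r) (k n : ℕ) :
    ∀ (G : Set E) (x : α), G.ncard = n →
      (∀ X : Set α, v ∈ X → r ∉ X → x ∈ X → k ≤ rho tail head G X) →
      (∀ X : Set α, v ∈ X → r ∉ X → x ∉ X → k + 1 ≤ rho tail head G X) →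
      ∃ H ⊆ G, (∀ X : Set α, v ∈ X → r ∉ X → k ≤ rho tail head H X) ∧
        (Relation.ReflTransGen (EdgeStep tail head (G \ H)) x v ∨
          Relation.ReflTransGen (EdgeStep tail head (G \ H)) r v) := by
  induction n using Nat.strong_induction_on with
  | _ n ih =>
  intro G x hn hin hout
  by_cases hxv : x = v
  · subst hxv
    exact ⟨G, subset_rfl, fun X hv hr => hin X hv hr hv, Or.inl .refl⟩
  have remove : ∀ f ∈ G,
      (∀ X : Set α, v ∈ X → r ∉ X → head f ∈ X → k ≤ rho tail head (G \ {f}) X) →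
      (∀ X : Set α, v ∈ X → r ∉ X → head f ∉ X → k + 1 ≤ rho tail head (G \ {f}) X) →
      ∃ H ⊆ G, (∀ X : Set α, v ∈ X → r ∉ X → k ≤ rho tail head H X) ∧
        (Relation.ReflTransGen (EdgeStep tail head (G \ H)) (tail f) v ∨
          Relation.ReflTransGen (EdgeStep tail head (G \ H)) r v) := by
    intro f hf h₁ h₂
    obtain ⟨H, hHG, hH, hreach⟩ := ih (G \ {f}).ncard
      (hn ▸ Set.ncard_sdiff_singleton_lt_of_mem hf (Set.toFinite _)) (G \ {f}) (head f) rfl h₁ h₂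
    have hmono : ∀ a b, EdgeStep tail head ((G \ {f}) \ H) a b →
        EdgeStep tail head (G \ H) a b :=
      fun a b ⟨e, he, hab⟩ => ⟨e, ⟨he.1.1, he.2⟩, hab⟩
    refine ⟨H, hHG.trans Set.sdiff_subset, hH, hreach.imp (fun h => ?_) fun h => Relation.ReflTransGen.mono hmono _ _ h⟩
    exact .head ⟨f, ⟨hf, fun hfH => (hHG hfH).2 rfl⟩, rfl, rfl⟩ (Relation.ReflTransGen.mono hmono _ _ h)
  by_cases htight : ∃ Z : Set α, v ∈ Z ∧ r ∉ Z ∧ x ∈ Z ∧ rho tail head G Z = k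
  · obtain ⟨Z, ⟨hvZ, hrZ, hxZ, hZ⟩, hmin⟩ := exists_minimal_of_wellFoundedLT
      (fun Z : Set α => v ∈ Z ∧ r ∉ Z ∧ x ∈ Z ∧ rho tail head G Z = k) htight
    have hedge : ∃ f ∈ G, tail f = x ∧ head f ∈ Z := by
      by_contra! hno
      have hlt := hout (Z \ {x}) ⟨hvZ, Ne.symm hxv⟩ (fun h => hrZ h.1) (by simp)
      have hle : rho tail head G (Z \ {x}) ≤ rho tail head G Z := by
        refine Set.ncard_le_ncard ?_ (Set.toFinite _)
        rintro e ⟨he, het, heh⟩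
        exact ⟨he, fun h => het ⟨h, fun hx => hno e he hx heh.1⟩, heh.1⟩
      omega
    obtain ⟨f, hf, rfl, hfZ⟩ := hedge
    refine remove f hf (fun X hv hr hfX => ?_) (fun X hv hr hfX => ?_)
    · by_cases htX : tail f ∈ X
      · rw [rho_diff_singleton_of_not_enters _ _ _ (fun h => h.1 htX)]
        exact hin X hv hr htX
      · have := rho_le_rho_diff_singleton_add_one (tail := tail) (head := head) G X f
        have := hout X hv hr htX
        omega
    · rw [rho_diff_singleton_of_not_enters _ _ _ (fun h => hfX h.2)]
      by_cases htX : tail f ∈ X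
      · refine Nat.succ_le_of_lt (lt_of_le_of_ne (hin X hv hr htX) fun hX => hfX ?_)
        have hi := hin (Z ∩ X) ⟨hvZ, hv⟩ (fun h => hr h.2) ⟨hxZ, htX⟩
        have hu := hin (Z ∪ X) (Or.inl hvZ) (fun h => h.elim hrZ hr) (Or.inl hxZ)
        have hsub := rho_inter_add_rho_union_le (tail := tail) (head := head) G Z X
        have hle : Z ⊆ Z ∩ X := hmin ⟨⟨hvZ, hv⟩, fun h => hr h.2, ⟨hxZ, htX⟩, by omega⟩
          Set.inter_subset_left
        exact (hle hfZ).2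
      · exact hout X hv hr htX
  · have hall : ∀ X : Set α, v ∈ X → r ∉ X → k + 1 ≤ rho tail head G X := by
      intro X hv hr
      by_cases hx : x ∈ X
      · exact Nat.succ_le_of_lt (lt_of_le_of_ne (hin X hv hr hx)
          fun h => htight ⟨X, hv, hr, hx, h.symm⟩)
      · exact hout X hv hr hx
    obtain ⟨f, hf, hfr, -⟩ : {e ∈ G | tail e ∉ ({r}ᶜ : Set α) ∧ head e ∈ ({r}ᶜ : Set α)}.Nonempty :=
      Set.nonempty_of_ncard_ne_zero
        (Nat.pos_iff_ne_zero.1 (Nat.lt_of_lt_of_le k.succ_pos (hall {r}ᶜ hvr (by simp))))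
    obtain rfl : tail f = r := by simpa using hfr
    obtain ⟨H, hHG, hH, hreach⟩ := remove f hf
      (fun X hv hr _ => by
        have := rho_le_rho_diff_singleton_add_one (tail := tail) (head := head) G X f
        have := hall X hv hr
        omega)
      (fun X hv hr hfX => by
        rw [rho_diff_singleton_of_not_enters _ _ _ (fun h => hfX h.2)]
        exact hall X hv hr)
    exact ⟨H, hHG, hH, Or.inr (hreach.elim id id)⟩

lemma hasEDPaths_of_le_rho [Finite α] {r v : α} (hvr : v ≠ r) (k : ℕ) :
    ∀ G : Set E, (∀ X : Set α, v ∈ X → r ∉ X → k ≤ rho tail head G X) →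
      HasEDPaths tail head G r v k := by
  induction k with
  | zero => exact fun G _ => ⟨fun i => i.elim0, fun i => i.elim0, fun i => i.elim0⟩
  | succ k ih =>
    intro G hG
    obtain ⟨H, hHG, hH, hreach⟩ := exists_subset_le_rho_and_reachable hvr k G.ncard G r rfl
      (fun X _ hr hr' => absurd hr' hr) (fun X hv hr _ => hG X hv hr)
    obtain ⟨p, hp⟩ := exists_isRVPath_of_reachable (hreach.elim id id) hvr.symm
    obtain ⟨P, hP, hdisj⟩ := ih H hH
    refine ⟨Fin.cons p P, fun i => ?_, fun i j hij e => ?_⟩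
    · cases i using Fin.cases with
      | zero => exact ⟨fun e he => (hp.1 e he).1, hp.2⟩
      | succ i => exact ⟨fun e he => hHG ((hP i).1 e he), (hP i).2⟩
    · cases i using Fin.cases with
      | zero =>
        cases j using Fin.cases with
        | zero => exact absurd rfl hij
        | succ j => exact fun he hej => (hp.1 e he).2 ((hP j).1 e hej)
      | succ i =>
        cases j using Fin.cases with
        | zero => exact fun hei he => (hp.1 e he).2 ((hP i).1 e hei)
        | succ j => exact hdisj i j (fun h => hij (h ▸ rfl)) e

lemma bddAbove_hasEDPaths (F : Set E) {r v : α} (hvr : v ≠ r) :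
    BddAbove {n | HasEDPaths tail head F r v n} :=
  ⟨rho tail head F {r}ᶜ, fun _ hn => hn.le_rho hvr (by simp)⟩

lemma lam_le_rho (F : Set E) {r v : α} {X : Set α} (hv : v ∈ X) (hr : r ∉ X) :
    lam tail head F r v ≤ rho tail head F X :=
  csSup_le ⟨0, fun i => i.elim0, fun i => i.elim0, fun i => i.elim0⟩ fun _ hn => hn.le_rho hv hr

/-- Menger's theorem for local edge-connectivity. -/
lemma le_lam_of_le_rho [Finite α] {F : Set E} {r v : α} (hvr : v ≠ r) {k : ℕ}
    (h : ∀ X : Set α, v ∈ X → r ∉ X → k ≤ rho tail head F X) : k ≤ lam tail head F r v :=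
  le_csSup (bddAbove_hasEDPaths F hvr) (hasEDPaths_of_le_rho hvr k F h)

lemma exists_tight [Finite α] (F : Set E) {r v : α} (hvr : v ≠ r) :
    ∃ X, Tight tail head F r v X := by
  by_contra! hno
  have : lam tail head F r v + 1 ≤ lam tail head F r v := le_lam_of_le_rho hvr fun X hv hr =>
    Nat.succ_le_of_lt (lt_of_le_of_ne (lam_le_rho F hv hr) fun h => hno X ⟨hv, hr, h.symm⟩)
  omega

lemma lam_mono [Finite α] {F G : Set E} (h : F ⊆ G) {r v : α} (hvr : v ≠ r) :
    lam tail head F r v ≤ lam tail head G r v := by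
  obtain ⟨X, hv, hr, hX⟩ := exists_tight (tail := tail) (head := head) G hvr
  exact (lam_le_rho F hv hr).trans ((rho_mono h X).trans hX.le)

/-- An edge whose removal lowers the local edge-connectivity of some vertex `u` enters a
`u`-tight set. -/
lemma exists_tight_entered [Finite α] {F : Set E} {r u : α} (hur : u ≠ r) {e : E}
    (h : lam tail head (F \ {e}) r u ≠ lam tail head F r u) :
    ∃ X, Tight tail head F r u X ∧ tail e ∉ X ∧ head e ∈ X := by
  by_contra! hno
  refine h (le_antisymm (lam_mono Set.sdiff_subset hur) (le_lam_of_le_rho hur fun X hu hr => ?_))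
  have hle := lam_le_rho (tail := tail) (head := head) F hu hr
  by_cases hX : tail e ∉ X ∧ head e ∈ X
  · have hne : rho tail head F X ≠ lam tail head F r u :=
      fun hX' => hno X ⟨hu, hr, hX'⟩ hX.1 hX.2
    have := rho_le_rho_diff_singleton_add_one (tail := tail) (head := head) F X e
    omega
  · rwa [rho_diff_singleton_of_not_enters _ _ _ hX]

lemma Tight.inter {F : Set E} {r u v : α} {T X : Set α} (hT : Tight tail head F r v T)
    (hX : Tight tail head F r u X) (hv : v ∈ X) : Tight tail head F r v (T ∩ X) := by
  obtain ⟨hvT, hrT, hT⟩ := hT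
  obtain ⟨huX, hrX, hX⟩ := hX
  refine ⟨⟨hvT, hv⟩, fun h => hrX h.2, ?_⟩
  have hsub := rho_inter_add_rho_union_le (tail := tail) (head := head) F T X
  have hi := lam_le_rho (tail := tail) (head := head) F (X := T ∩ X) ⟨hvT, hv⟩
    (fun h : r ∈ T ∩ X => hrX h.2)
  have hu := lam_le_rho (tail := tail) (head := head) F (X := T ∪ X) (Or.inr huX)
    (fun h : r ∈ T ∪ X => h.elim hrT hrX)
  omega

lemma lam_le_inDeg (F : Set E) {r v : α} (hvr : v ≠ r) :
    lam tail head F r v ≤ inDeg head F v :=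
  (lam_le_rho F (Set.mem_singleton v) (fun h => hvr h.symm)).trans
    (Set.ncard_le_ncard (fun _ he => ⟨he.1, he.2.2⟩) (Set.toFinite _))

end Menger

/-- Lovász: every rooted digraph `D = (V+r, E)` has a spanning
subgraph `F` such that `λ_D(r,v) = λ_F(r,v) = ϱ_F(v)` for every `v ∈ V`. -/
theorem lovasz_maximal_flame_exists
    {α E : Type*} [Fintype α] [Fintype E] (tail head : E → α) (r : α) :
    ∃ F : Set E, ∀ v, v ≠ r →
      lam tail head Set.univ r v = lam tail head F r v ∧
      lam tail head F r v = inDeg head F v := by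
  obtain ⟨F, hF, hmin⟩ := exists_minimal_of_wellFoundedLT
    (fun F : Set E => ∀ v, v ≠ r → lam tail head Set.univ r v = lam tail head F r v)
    ⟨Set.univ, fun _ _ => rfl⟩
  refine ⟨F, fun v hvr => ⟨hF v hvr, le_antisymm (lam_le_inDeg F hvr) ?_⟩⟩
  obtain ⟨T, hT, hTmin⟩ := exists_minimal_of_wellFoundedLT
    (Tight tail head F r v) (exists_tight F hvr)
  rw [← hT.2.2]
  refine Set.ncard_le_ncard ?_ (Set.toFinite _)
  rintro e ⟨he, rfl⟩
  refine ⟨he, fun heT => ?_, hT.1⟩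
  obtain ⟨u, hur, hu⟩ : ∃ u, u ≠ r ∧
      lam tail head (F \ {e}) r u ≠ lam tail head F r u := by
    by_contra! h
    exact (hmin (fun u hur => (hF u hur).trans (h u hur).symm) Set.sdiff_subset he).2 rfl
  obtain ⟨X, hX, heX, hvX⟩ := exists_tight_entered hur hu
  exact heX (hTmin (hT.inter hX hvX) Set.inter_subset_left heT).2
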